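/- arXiv:2506.03042 — 3 statements merged into one kernel-verified Lean document; each statement's English description precedes it below -/
import Mathlib

section
/- For real numbers σ₁, σ₂, κ₁, κ₂ > 0 with κ₁ ≠ κ₂ and any ρ ∈ ℝ, with normalizing constants c₁ = 1/(2√π·σ₁·κ₁) and c₂ = 1/(2√π·σ₂·κ₂), the quantity (ρ/(c₁·c₂·√(1+ρ²)·(2π)²)) · ∫_{ℝ²} dk/((κ₁² + ‖k‖²)(κ₂² + ‖k‖²)) equals 2ρ·σ₁·σ₂·κ₁·κ₂·ln(κ₁/κ₂)/(√(1+ρ²)·(κ₁² − κ₂²)). -/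
open MeasureTheory Real

open Filter Topology in
/-- The ratio of two shifted squares tends to one at infinity, in logarithmic form. -/
lemma tendsto_log_add_sq_sub_log_add_sq {a b : ℝ} (ha : 0 < a) (hb : 0 < b) :
    Tendsto (fun r : ℝ => log (b + r ^ 2) - log (a + r ^ 2)) atTop (𝓝 0) := by
  have hden : Tendsto (fun r : ℝ => a + r ^ 2) atTop atTop :=
    tendsto_atTop_add_const_left _ _ (tendsto_pow_atTop two_ne_zero)
  have hratio : Tendsto (fun r : ℝ => 1 + (b - a) / (a + r ^ 2)) atTop (𝓝 1) := by
    simpa using (hden.const_div_atTop (b - a)).const_add 1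
  have hlog := hratio.log one_ne_zero
  rw [log_one] at hlog
  refine hlog.congr fun r => ?_
  have ha' : a + r ^ 2 ≠ 0 := by positivity
  have hb' : b + r ^ 2 ≠ 0 := by positivity
  rw [← log_div hb' ha']
  congr 1
  field_simp
  ring

lemma hasDerivAt_log_add_sq {a : ℝ} (ha : 0 < a) (r : ℝ) :
    HasDerivAt (fun r : ℝ => log (a + r ^ 2)) (2 * r / (a + r ^ 2)) r := by
  have h := ((hasDerivAt_pow 2 r).const_add a).log (by positivity)
  simpa using h

/-- The radial integral arising from the product of two Matérn spectral factors in the plane. -/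
lemma integral_Ioi_div_add_sq_mul_add_sq {a b : ℝ} (ha : 0 < a) (hb : 0 < b) (hab : a ≠ b) :
    ∫ r in Set.Ioi (0 : ℝ), r / ((a + r ^ 2) * (b + r ^ 2)) =
      (log a - log b) / (2 * (a - b)) := by
  have hsub : a - b ≠ 0 := sub_ne_zero.mpr hab
  have hderiv (r : ℝ) : HasDerivAt
      (fun r : ℝ => (log (b + r ^ 2) - log (a + r ^ 2)) / (2 * (a - b)))
      (r / ((a + r ^ 2) * (b + r ^ 2))) r := by
    have ha' : a + r ^ 2 ≠ 0 := by positivity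
    have hb' : b + r ^ 2 ≠ 0 := by positivity
    refine (((hasDerivAt_log_add_sq hb r).sub
      (hasDerivAt_log_add_sq ha r)).div_const (2 * (a - b))).congr_deriv ?_
    field_simp
    ring
  rw [integral_Ioi_of_hasDerivAt_of_nonneg' (fun r _ => hderiv r)
    (fun r hr => by have : 0 < r := hr; positivity)
    ((tendsto_log_add_sq_sub_log_add_sq ha hb).div_const _)]
  simp only [ne_eq, OfNat.ofNat_ne_zero, not_false_eq_true, zero_pow, add_zero]
  ring

/-- Integration of a radial function over the Euclidean plane in polar coordinates. -/
lemma integral_fun_norm_euclideanSpace_fin_two (f : ℝ → ℝ) :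
    ∫ k : EuclideanSpace ℝ (Fin 2), f ‖k‖ = 2 * π * ∫ r in Set.Ioi (0 : ℝ), r * f r := by
  rw [integral_fun_norm_addHaar volume f, Measure.real, EuclideanSpace.volume_ball_fin_two]
  simp [pi_pos.le, mul_assoc]

lemma integral_one_div_add_norm_sq_mul_add_norm_sq {a b : ℝ} (ha : 0 < a) (hb : 0 < b)
    (hab : a ≠ b) :
    ∫ k : EuclideanSpace ℝ (Fin 2), 1 / ((a + ‖k‖ ^ 2) * (b + ‖k‖ ^ 2)) =
      π * (log a - log b) / (a - b) := by
  rw [integral_fun_norm_euclideanSpace_fin_two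
    (fun r => 1 / ((a + r ^ 2) * (b + r ^ 2)))]
  simp only [mul_one_div]
  rw [integral_Ioi_div_add_sq_mul_add_sq ha hb hab]
  have hsub : a - b ≠ 0 := sub_ne_zero.mpr hab
  field_simp

/-- Zero-lag cross-covariance of the bivariate Matérn–SPDE field with `α₁ = α₂ = 2`, `d = 2`:
with `c₁ = 1/(2√π σ₁ κ₁)` and `c₂ = 1/(2√π σ₂ κ₂)`,
`(ρ/(c₁c₂√(1+ρ²)(2π)²)) · ∫_{ℝ²} dk/((κ₁²+‖k‖²)(κ₂²+‖k‖²))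
  = 2ρσ₁σ₂κ₁κ₂ ln(κ₁/κ₂)/(√(1+ρ²)(κ₁²−κ₂²))`. -/
theorem zero_lag_cross_covariance (σ₁ σ₂ κ₁ κ₂ ρ : ℝ)
    (hσ₁ : 0 < σ₁) (hσ₂ : 0 < σ₂) (hκ₁ : 0 < κ₁) (hκ₂ : 0 < κ₂) (hne : κ₁ ≠ κ₂)
    (c₁ c₂ : ℝ) (hc₁ : c₁ = 1 / (2 * Real.sqrt π * σ₁ * κ₁))
    (hc₂ : c₂ = 1 / (2 * Real.sqrt π * σ₂ * κ₂)) :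
    (ρ / (c₁ * c₂ * Real.sqrt (1 + ρ ^ 2) * (2 * π) ^ 2)) *
        ∫ k : EuclideanSpace ℝ (Fin 2),
          1 / ((κ₁ ^ 2 + ‖k‖ ^ 2) * (κ₂ ^ 2 + ‖k‖ ^ 2)) =
      2 * ρ * σ₁ * σ₂ * κ₁ * κ₂ * Real.log (κ₁ / κ₂) /
        (Real.sqrt (1 + ρ ^ 2) * (κ₁ ^ 2 - κ₂ ^ 2)) := by
  have hsq : κ₁ ^ 2 ≠ κ₂ ^ 2 := fun h => hne ((sq_eq_sq₀ hκ₁.le hκ₂.le).mp h)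
  have hsub : κ₁ ^ 2 - κ₂ ^ 2 ≠ 0 := sub_ne_zero.mpr hsq
  have hρ : √(1 + ρ ^ 2) ≠ 0 := by positivity
  rw [integral_one_div_add_norm_sq_mul_add_norm_sq (by positivity) (by positivity) hsq,
    log_pow, log_pow, log_div hκ₁.ne' hκ₂.ne']
  have hc : c₁ * c₂ = 1 / (4 * π * σ₁ * σ₂ * κ₁ * κ₂) := by
    rw [hc₁, hc₂, div_mul_div_comm, one_mul]
    congr 1
    linear_combination (4 * σ₁ * σ₂ * κ₁ * κ₂) * mul_self_sqrt pi_pos.le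
  rw [hc]
  push_cast
  field_simp
  ring
end

section
/- For every θ ∈ ℝ and ρ ∈ ℝ, the matrix product D(θ,ρ)ᵀ · D(θ,ρ) equals the 2×2 matrix with diagonal entries 1+ρ² and off-diagonal entries −ρ·√(1+ρ²). In particular, D(θ,ρ)ᵀ·D(θ,ρ) does not depend on θ. -/
open Real Matrix

/-- The dependence matrix of the bivariate Matérn–SPDE system. -/
noncomputable def depMatrix (θ ρ : ℝ) : Matrix (Fin 2) (Fin 2) ℝ :=
  !![Real.cos θ + ρ * Real.sin θ, -Real.sin θ * Real.sqrt (1 + ρ ^ 2);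
     Real.sin θ - ρ * Real.cos θ, Real.cos θ * Real.sqrt (1 + ρ ^ 2)]

/-- The Gram matrix of the columns of `depMatrix θ ρ`. -/
lemma depMatrix_gram (θ ρ : ℝ) :
    (depMatrix θ ρ)ᵀ * depMatrix θ ρ =
      !![1 + ρ ^ 2, -ρ * Real.sqrt (1 + ρ ^ 2);
         -ρ * Real.sqrt (1 + ρ ^ 2), 1 + ρ ^ 2] := by
  have htrig := Real.sin_sq_add_cos_sq θ
  have hsqrt : Real.sqrt (1 + ρ ^ 2) ^ 2 = 1 + ρ ^ 2 := Real.sq_sqrt (by positivity)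
  ext i j
  fin_cases i <;> fin_cases j <;>
    simp only [depMatrix, Matrix.mul_apply, Fin.sum_univ_two, Matrix.transpose_apply,
      Matrix.of_apply, Matrix.cons_val_zero, Matrix.cons_val_one, Matrix.cons_val_fin_one,
      Fin.zero_eta, Fin.mk_one]
  · linear_combination (1 + ρ ^ 2) * htrig
  · linear_combination -ρ * Real.sqrt (1 + ρ ^ 2) * htrig
  · linear_combination -ρ * Real.sqrt (1 + ρ ^ 2) * htrig
  · linear_combination Real.sqrt (1 + ρ ^ 2) ^ 2 * htrig + hsqrt

/-- `D(θ,ρ)ᵀ · D(θ,ρ)` has diagonal entries `1+ρ²` and off-diagonal entries `−ρ√(1+ρ²)`;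
in particular it does not depend on `θ`. -/
theorem depMatrix_transpose_mul_self (θ ρ : ℝ) :
    ((depMatrix θ ρ)ᵀ * depMatrix θ ρ =
      !![1 + ρ ^ 2, -ρ * Real.sqrt (1 + ρ ^ 2);
         -ρ * Real.sqrt (1 + ρ ^ 2), 1 + ρ ^ 2]) ∧
    ∀ θ' : ℝ, (depMatrix θ ρ)ᵀ * depMatrix θ ρ = (depMatrix θ' ρ)ᵀ * depMatrix θ' ρ := by
  exact ⟨depMatrix_gram θ ρ, fun θ' => (depMatrix_gram θ ρ).trans (depMatrix_gram θ' ρ).symm⟩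
end

section
/- Let σ > 0, μ, y ∈ ℝ, and let X, X′ be independent random variables with distribution N(μ, σ²). Set z = (y − μ)/σ. Then E|X − y| − ½·E|X − X′| = σ·[z·(2Φ(z) − 1) + 2φ(z) − 1/√π], where φ and Φ are the standard normal density and distribution function. -/
open MeasureTheory Real ProbabilityTheory

/-- The standard normal probability density function `φ`. -/
noncomputable def stdNormalPDF (x : ℝ) : ℝ := Real.exp (-x ^ 2 / 2) / Real.sqrt (2 * π)

/-- The standard normal cumulative distribution function `Φ`. -/
noncomputable def stdNormalCDF (x : ℝ) : ℝ := ∫ t in Set.Iic x, stdNormalPDF t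

lemma stdNormalPDF_eq_gaussianPDFReal : stdNormalPDF = gaussianPDFReal 0 1 := by
  ext x
  simp [stdNormalPDF, gaussianPDFReal, div_eq_inv_mul]

lemma integrable_stdNormalPDF : Integrable stdNormalPDF := by
  rw [stdNormalPDF_eq_gaussianPDFReal]
  exact integrable_gaussianPDFReal 0 1

lemma integral_stdNormalPDF : ∫ x, stdNormalPDF x = 1 := by
  rw [stdNormalPDF_eq_gaussianPDFReal]
  exact integral_gaussianPDFReal_eq_one 0 one_ne_zero

lemma integrable_mul_stdNormalPDF : Integrable fun x ↦ x * stdNormalPDF x := by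
  convert! (integrable_mul_exp_neg_mul_sq (b := 1 / 2) (by norm_num)).div_const √(2 * π) using 2
    with x
  rw [stdNormalPDF, mul_div_assoc]
  ring_nf

lemma hasDerivAt_neg_stdNormalPDF (x : ℝ) :
    HasDerivAt (fun t ↦ -stdNormalPDF t) (x * stdNormalPDF x) x := by
  unfold stdNormalPDF
  convert! (((((hasDerivAt_id x).pow 2).neg.div_const 2).exp).div_const √(2 * π)).neg using 1
  simp
  ring

lemma tendsto_stdNormalPDF_cocompact :
    Filter.Tendsto stdNormalPDF (Filter.cocompact ℝ) (nhds 0) := by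
  have h := (tendsto_rpow_abs_mul_exp_neg_mul_sq_cocompact (a := 1 / 2) (by norm_num) 0).div_const
    √(2 * π)
  rw [zero_div] at h
  refine h.congr fun x ↦ ?_
  rw [stdNormalPDF, rpow_zero, one_mul]
  ring_nf

lemma setIntegral_Iic_mul_stdNormalPDF (z : ℝ) :
    ∫ x in Set.Iic z, x * stdNormalPDF x = -stdNormalPDF z := by
  have h := integral_Iic_of_hasDerivAt_of_tendsto' (a := z)
    (fun x _ ↦ hasDerivAt_neg_stdNormalPDF x) integrable_mul_stdNormalPDF.integrableOn
    (tendsto_stdNormalPDF_cocompact.mono_left atBot_le_cocompact).neg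
  simpa using h

lemma setIntegral_Ioi_mul_stdNormalPDF (z : ℝ) :
    ∫ x in Set.Ioi z, x * stdNormalPDF x = stdNormalPDF z := by
  have h := integral_Ioi_of_hasDerivAt_of_tendsto' (a := z)
    (fun x _ ↦ hasDerivAt_neg_stdNormalPDF x) integrable_mul_stdNormalPDF.integrableOn
    (tendsto_stdNormalPDF_cocompact.mono_left atTop_le_cocompact).neg
  simpa using h

lemma setIntegral_Ioi_stdNormalPDF (z : ℝ) :
    ∫ x in Set.Ioi z, stdNormalPDF x = 1 - stdNormalCDF z := by
  have h := intervalIntegral.integral_Iic_add_Ioi (b := z)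
    integrable_stdNormalPDF.integrableOn integrable_stdNormalPDF.integrableOn
  rw [integral_stdNormalPDF] at h
  rw [stdNormalCDF]
  linarith

/-- The mean absolute deviation of a standard normal variable from a point `z`. -/
lemma integral_abs_sub_gaussianReal_zero_one (z : ℝ) :
    ∫ x, |x - z| ∂(gaussianReal 0 1) =
      z * (2 * stdNormalCDF z - 1) + 2 * stdNormalPDF z := by
  have hsub : Integrable fun x ↦ x * stdNormalPDF x - z * stdNormalPDF x :=
    integrable_mul_stdNormalPDF.sub (integrable_stdNormalPDF.const_mul z)
  have hpos (x : ℝ) : 0 ≤ stdNormalPDF x := by unfold stdNormalPDF; positivity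
  have habs : Integrable fun x ↦ stdNormalPDF x * |x - z| := by
    convert! hsub.abs using 2 with x
    rw [← sub_mul, abs_mul, abs_of_nonneg (hpos x), mul_comm]
  have hIic : ∫ x in Set.Iic z, stdNormalPDF x * |x - z| =
      z * stdNormalCDF z + stdNormalPDF z := by
    calc _ = ∫ x in Set.Iic z, (z * stdNormalPDF x - x * stdNormalPDF x) := by
          refine setIntegral_congr_fun measurableSet_Iic fun x hx ↦ ?_
          simp only [abs_of_nonpos (sub_nonpos.2 (Set.mem_Iic.1 hx))]
          ring
      _ = _ := by
          rw [integral_sub (integrable_stdNormalPDF.const_mul z).integrableOn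
            integrable_mul_stdNormalPDF.integrableOn, integral_const_mul,
            setIntegral_Iic_mul_stdNormalPDF, sub_neg_eq_add, stdNormalCDF]
  have hIoi : ∫ x in Set.Ioi z, stdNormalPDF x * |x - z| =
      stdNormalPDF z - z * (1 - stdNormalCDF z) := by
    calc _ = ∫ x in Set.Ioi z, (x * stdNormalPDF x - z * stdNormalPDF x) := by
          refine setIntegral_congr_fun measurableSet_Ioi fun x hx ↦ ?_
          simp only [abs_of_pos (sub_pos.2 (Set.mem_Ioi.1 hx))]
          ring
      _ = _ := by
          rw [integral_sub integrable_mul_stdNormalPDF.integrableOn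
            (integrable_stdNormalPDF.const_mul z).integrableOn, integral_const_mul,
            setIntegral_Ioi_mul_stdNormalPDF, setIntegral_Ioi_stdNormalPDF]
  rw [integral_gaussianReal_eq_integral_smul one_ne_zero, ← stdNormalPDF_eq_gaussianPDFReal]
  simp only [smul_eq_mul]
  rw [← intervalIntegral.integral_Iic_add_Ioi (b := z) habs.integrableOn habs.integrableOn,
    hIic, hIoi]
  ring

/-- The mean absolute deviation of a normal variable with positive standard deviation `s` from a
point `y`. -/
lemma integral_abs_sub_gaussianReal (m y : ℝ) {s : ℝ} (hs : 0 < s) (v : NNReal)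
    (hv : (v : ℝ) = s ^ 2) :
    ∫ x, |x - y| ∂(gaussianReal m v) =
      s * ((y - m) / s * (2 * stdNormalCDF ((y - m) / s) - 1) +
        2 * stdNormalPDF ((y - m) / s)) := by
  have hmap : gaussianReal m v = (gaussianReal 0 1).map (fun x ↦ s * x + m) := by
    rw [← Function.comp_def (· + m) (s * ·), ← Measure.map_map (by fun_prop) (by fun_prop),
      gaussianReal_map_const_mul, gaussianReal_map_add_const]
    congr 1
    · simp
    · ext
      simp [hv]
  rw [hmap, integral_map (by fun_prop) (by fun_prop), ← integral_abs_sub_gaussianReal_zero_one,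
    ← integral_const_mul]
  refine integral_congr_ae (ae_of_all _ fun x ↦ ?_)
  change |s * x + m - y| = s * |x - (y - m) / s|
  rw [← abs_of_pos hs, ← abs_mul, abs_of_pos hs]
  congr 1
  field_simp
  ring

lemma gaussianReal_prod_map_sub (m₁ m₂ : ℝ) (v₁ v₂ : NNReal) :
    ((gaussianReal m₁ v₁).prod (gaussianReal m₂ v₂)).map (fun p ↦ p.1 - p.2) =
      gaussianReal (m₁ - m₂) (v₁ + v₂) := by
  have hind : IndepFun (fun p : ℝ × ℝ ↦ p.1) (fun p ↦ -p.2)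
      ((gaussianReal m₁ v₁).prod (gaussianReal m₂ v₂)) :=
    indepFun_prod (X := fun x ↦ x) (Y := fun x ↦ -x) (by fun_prop) (by fun_prop)
  have h := gaussianReal_add_gaussianReal_of_indepFun hind
    (measurePreserving_fst.map_eq) (m₂ := -m₂) (v₂ := v₂) (by
      rw [← Function.comp_def (fun x : ℝ ↦ -x) Prod.snd,
        ← Measure.map_map (by fun_prop) (by fun_prop), measurePreserving_snd.map_eq,
        gaussianReal_map_neg])
  simpa only [sub_eq_add_neg] using! h

/-- Gini's mean difference of a normal distribution. -/
lemma integral_abs_sub_gaussianReal_prod (m : ℝ) {s : ℝ} (hs : 0 < s) (v : NNReal)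
    (hv : (v : ℝ) = s ^ 2) :
    ∫ p : ℝ × ℝ, |p.1 - p.2| ∂((gaussianReal m v).prod (gaussianReal m v)) =
      2 * s / √π := by
  have h := integral_map (μ := (gaussianReal m v).prod (gaussianReal m v))
    (φ := fun p ↦ p.1 - p.2) (f := fun x : ℝ ↦ |x - 0|) (by fun_prop) (by fun_prop)
  rw [gaussianReal_prod_map_sub, integral_abs_sub_gaussianReal _ _ (s := √2 * s) (by positivity) _
    (by rw [mul_pow, sq_sqrt (by norm_num)]; push_cast; rw [hv]; ring)] at h
  simp only [sub_zero] at h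
  rw [← h]
  simp [stdNormalPDF]
  field_simp

/-- Closed form of the CRPS of `N(μ, σ²)` at `y`: with `z = (y − μ)/σ` and `X, X′`
independent `N(μ, σ²)`, `E|X − y| − ½E|X − X′| = σ[z(2Φ(z) − 1) + 2φ(z) − 1/√π]`. -/
theorem crps_gaussian_closed_form (μ σ y : ℝ) (hσ : 0 < σ) (z : ℝ)
    (hz : z = (y - μ) / σ) :
    (∫ x, |x - y| ∂(gaussianReal μ ⟨σ ^ 2, sq_nonneg σ⟩)) -
        (1 / 2) * ∫ p : ℝ × ℝ, |p.1 - p.2|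
          ∂((gaussianReal μ ⟨σ ^ 2, sq_nonneg σ⟩).prod
              (gaussianReal μ ⟨σ ^ 2, sq_nonneg σ⟩)) =
      σ * (z * (2 * stdNormalCDF z - 1) + 2 * stdNormalPDF z - 1 / Real.sqrt π) := by
  have hv : ((⟨σ ^ 2, sq_nonneg σ⟩ : NNReal) : ℝ) = σ ^ 2 := rfl
  rw [integral_abs_sub_gaussianReal μ y hσ _ hv, integral_abs_sub_gaussianReal_prod μ hσ _ hv, hz]
  ring
end
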